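/- Let S = {(1,0),(−1,0),(0,1),(0,−1),(1,−1),(−1,1)} (Model 18). Then the equal-weight interacting generating function G_S(t;a,a) ∈ ℚ[a][[t]] is a ratio of D-finite series: there exist D-finite power series F, H ∈ ℚ[a][[t]] with H ≠ 0 such that H·G_S(t;a,a) = F. -/

import Mathlib

open PowerSeries

/-- A quarter-plane loop of length `n` with steps in `S`: a sequence of points of
`ℤ≥0 × ℤ≥0` (encoded as `ℕ × ℕ`) starting and ending at the origin, with successive
differences in `S`. -/
def IsQPLoop (S : Set (ℤ × ℤ)) (n : ℕ) (w : Fin (n + 1) → ℕ × ℕ) : Prop :=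
  w 0 = (0, 0) ∧ w (Fin.last n) = (0, 0) ∧
    ∀ i : Fin n, (((w i.succ).1 : ℤ) - ((w i.castSucc).1 : ℤ),
      ((w i.succ).2 : ℤ) - ((w i.castSucc).2 : ℤ)) ∈ S

/-- The number of visits of `w` to the horizontal boundary: indices `1 ≤ i ≤ n`
with the second coordinate of `w i` equal to `0`. -/
def hvisits {n : ℕ} (w : Fin (n + 1) → ℕ × ℕ) : ℕ :=
  (Finset.univ.filter fun i : Fin (n + 1) => 0 < (i : ℕ) ∧ (w i).2 = 0).card

/-- The number of visits of `w` to the vertical boundary: indices `1 ≤ i ≤ n`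
with the first coordinate of `w i` equal to `0`. -/
def vvisits {n : ℕ} (w : Fin (n + 1) → ℕ × ℕ) : ℕ :=
  (Finset.univ.filter fun i : Fin (n + 1) => 0 < (i : ℕ) ∧ (w i).1 = 0).card

/-- The interacting generating function `G_S(t;a,b) = Σ_n t^n Σ_w a^(h(w)) b^(v(w))`,
the inner sum over all quarter-plane loops of length `n` with steps in `S`. -/
noncomputable def loopGF (S : Set (ℤ × ℤ)) {R : Type*} [CommRing R] (a b : R) :
    PowerSeries R :=
  PowerSeries.mk fun n =>
    ∑ᶠ w : {w : Fin (n + 1) → ℕ × ℕ // IsQPLoop S n w}, a ^ hvisits w.1 * b ^ vvisits w.1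

/-- A power series `F ∈ R[[t]]` is D-finite if there are polynomials `p₀, …, p_m`,
not all zero, with `Σ pᵢ · F⁽ⁱ⁾ = 0`, where `F⁽ⁱ⁾` is the `i`-th formal derivative. -/
def IsDFinite {R : Type*} [CommRing R] (F : PowerSeries R) : Prop :=
  ∃ (m : ℕ) (p : Fin (m + 1) → Polynomial R), (∃ i, p i ≠ 0) ∧
    ∑ i : Fin (m + 1), (p i : PowerSeries R) * (PowerSeries.derivativeFun)^[(i : ℕ)] F = 0

open scoped LaurentPolynomial

section LaurentDerivative

variable {R : Type*} [CommRing R]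

/-- The formal derivative of a Laurent polynomial. -/
noncomputable def laurentDeriv (R : Type*) [CommRing R] : R[T;T⁻¹] →ₗ[R] R[T;T⁻¹] :=
  (Finsupp.lsum R fun n : ℤ => (n : R) • AddMonoidAlgebra.lsingle (n - 1)) ∘ₗ
    (AddMonoidAlgebra.coeffLinearEquiv R).toLinearMap

lemma laurentDeriv_single (n : ℤ) (r : R) :
    laurentDeriv R (.single n r) = .single (n - 1) ((n : R) * r) := by
  have h : ((AddMonoidAlgebra.coeffLinearEquiv R).toLinearMap
      (AddMonoidAlgebra.single n r : R[T;T⁻¹])) = Finsupp.single n r := rfl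
  rw [laurentDeriv, LinearMap.comp_apply, h, Finsupp.lsum_single, LinearMap.smul_apply,
    AddMonoidAlgebra.lsingle_apply, AddMonoidAlgebra.smul_single, smul_eq_mul]

lemma coeff_laurentDeriv (p : R[T;T⁻¹]) (k : ℤ) :
    (laurentDeriv R p).coeff k = (k + 1 : ℤ) * p.coeff (k + 1) := by
  induction p using AddMonoidAlgebra.induction_linear with
  | zero => simp
  | add f g hf hg => simp [map_add, hf, hg, mul_add]
  | single n r =>
    rw [laurentDeriv_single]
    simp only [AddMonoidAlgebra.coeff_single, Finsupp.single_apply, sub_eq_iff_eq_add]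
    split_ifs with h
    · simp [h]
    · simp

lemma laurentDeriv_mul (p q : R[T;T⁻¹]) :
    laurentDeriv R (p * q) = p * laurentDeriv R q + q * laurentDeriv R p := by
  induction p using AddMonoidAlgebra.induction_linear with
  | zero => simp
  | add f g hf hg => simp only [add_mul, mul_add, map_add, hf, hg]; abel
  | single n r =>
    induction q using AddMonoidAlgebra.induction_linear with
    | zero => simp
    | add f g hf hg => simp only [add_mul, mul_add, map_add, hf, hg]; abel
    | single m s =>
      simp only [AddMonoidAlgebra.single_mul_single, laurentDeriv_single]
      rw [show n + (m - 1) = n + m - 1 by ring, show m + (n - 1) = n + m - 1 by ring,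
        ← AddMonoidAlgebra.single_add]
      congr 1
      push_cast
      ring

/-- Differentiation with respect to the Laurent variable `x` in `R[x, x⁻¹]⟦t⟧`. -/
noncomputable def xDeriv (R : Type*) [CommRing R] :
    Derivation R (PowerSeries R[T;T⁻¹]) (PowerSeries R[T;T⁻¹]) :=
  Derivation.mk'
    { toFun := fun f => PowerSeries.mk fun n => laurentDeriv R (coeff n f)
      map_add' := fun f g => by ext; simp
      map_smul' := fun r f => by ext1; simp }
    (fun f g => by
      ext1 n
      simp only [LinearMap.coe_mk, AddHom.coe_mk, coeff_mk, coeff_mul, smul_eq_mul, map_add,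
        map_sum, laurentDeriv_mul, Finset.sum_add_distrib]
      congr 1
      exact (Finset.Nat.sum_antidiagonal_swap (n := n)
        (f := fun p => coeff p.1 g * laurentDeriv R (coeff p.2 f))))

lemma coeff_xDeriv (f : PowerSeries R[T;T⁻¹]) (n : ℕ) :
    coeff n (xDeriv R f) = laurentDeriv R (coeff n f) := by
  simp [xDeriv]

/-- Extraction of the coefficient of `x ^ k` from a series in `R[x, x⁻¹]⟦t⟧`. -/
noncomputable def xCoeff (k : ℤ) : PowerSeries R[T;T⁻¹] →ₗ[R] PowerSeries R where
  toFun f := PowerSeries.mk fun n => (coeff n f).coeff k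
  map_add' f g := by ext; simp
  map_smul' r f := by ext; simp

lemma coeff_xCoeff (k : ℤ) (f : PowerSeries R[T;T⁻¹]) (n : ℕ) :
    coeff n (xCoeff k f) = (coeff n f).coeff k := by
  simp [xCoeff]

lemma xCoeff_derivative (k : ℤ) (f : PowerSeries R[T;T⁻¹]) :
    xCoeff k (derivative _ f) = derivative _ (xCoeff k f) := by
  ext n
  have h : ((n : R[T;T⁻¹]) + 1) = LaurentPolynomial.C ((n : R) + 1) := by simp
  rw [coeff_xCoeff, coeff_derivative, coeff_derivative, coeff_xCoeff, h, mul_comm,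
    ← LaurentPolynomial.smul_eq_C_mul, AddMonoidAlgebra.coeff_smul, Finsupp.smul_apply,
    smul_eq_mul, mul_comm]

lemma xCoeff_iterate_derivative (k : ℤ) (f : PowerSeries R[T;T⁻¹]) (n : ℕ) :
    xCoeff k ((derivative _)^[n] f) = (derivative _)^[n] (xCoeff k f) := by
  induction n with
  | zero => rfl
  | succ n ih => rw [Function.iterate_succ_apply', xCoeff_derivative, ih,
      ← Function.iterate_succ_apply' (f := derivative R)]

lemma xCoeff_iterate_xDeriv (k : ℤ) (f : PowerSeries R[T;T⁻¹]) (n : ℕ) :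
    xCoeff k ((xDeriv R)^[n] f) =
      ((∏ i ∈ Finset.range n, (k + 1 + i) : ℤ) : R) • xCoeff (k + n) f := by
  induction n generalizing k with
  | zero => simp
  | succ n ih =>
    have h : xCoeff k ((xDeriv R)^[n + 1] f) =
        ((k + 1 : ℤ) : R) • xCoeff (k + 1) ((xDeriv R)^[n] f) := by
      ext m
      rw [Function.iterate_succ_apply', coeff_xCoeff, coeff_xDeriv, coeff_laurentDeriv]
      simp [coeff_xCoeff]
    rw [h, ih, smul_smul, Finset.prod_range_succ', Nat.cast_succ]
    congr 1
    · rw [← Int.cast_mul]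
      congr 1
      rw [mul_comm]
      congr 1
      · exact Finset.prod_congr rfl fun i _ => by push_cast; ring
      · simp
    · congr 2; ring

/-- The embedding `R[t] → R[x, x⁻¹]⟦t⟧`. -/
noncomputable def tEmb (R : Type*) [CommRing R] : Polynomial R →+* PowerSeries R[T;T⁻¹] :=
  (PowerSeries.map LaurentPolynomial.C).comp Polynomial.coeToPowerSeries.ringHom

lemma tEmb_apply (p : Polynomial R) :
    tEmb R p = PowerSeries.map LaurentPolynomial.C (p : PowerSeries R) := rfl

/-- The embedding `R[t][x] → R[x, x⁻¹]⟦t⟧`. -/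
noncomputable def txEmb (R : Type*) [CommRing R] :
    Polynomial (Polynomial R) →+* PowerSeries R[T;T⁻¹] :=
  Polynomial.eval₂RingHom (tEmb R) (PowerSeries.C (LaurentPolynomial.T 1))

lemma txEmb_C (p : Polynomial R) : txEmb R (Polynomial.C p) = tEmb R p := by
  simp [txEmb]

lemma txEmb_X : txEmb R Polynomial.X = PowerSeries.C (LaurentPolynomial.T 1) := by
  simp [txEmb]

lemma xCoeff_map_mul (k : ℤ) (p : PowerSeries R) (f : PowerSeries R[T;T⁻¹]) :
    xCoeff k (PowerSeries.map LaurentPolynomial.C p * f) = p * xCoeff k f := by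
  ext n
  simp only [coeff_xCoeff, coeff_mul, coeff_map, ← LaurentPolynomial.smul_eq_C_mul,
    AddMonoidAlgebra.coeff_sum, Finsupp.coe_finsetSum, Finset.sum_apply,
    AddMonoidAlgebra.coeff_smul, Finsupp.smul_apply, smul_eq_mul]

lemma xDeriv_map (p : PowerSeries R) : xDeriv R (PowerSeries.map LaurentPolynomial.C p) = 0 := by
  ext1 n
  rw [coeff_xDeriv, coeff_map, ← LaurentPolynomial.single_eq_C, laurentDeriv_single]
  simp

lemma xDeriv_C_T : xDeriv R (PowerSeries.C (LaurentPolynomial.T 1)) = 1 := by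
  ext1 n
  rw [coeff_xDeriv, coeff_C, coeff_one]
  split_ifs
  · rw [LaurentPolynomial.T, laurentDeriv_single]
    simp
  · simp

lemma derivative_map (p : PowerSeries R) :
    derivative _ (PowerSeries.map (LaurentPolynomial.C (R := R)) p) =
      PowerSeries.map LaurentPolynomial.C (derivative _ p) := by
  ext1 n
  simp [coeff_derivative]

lemma xDeriv_txEmb (p : Polynomial (Polynomial R)) :
    xDeriv R (txEmb R p) = txEmb R (Polynomial.derivative p) := by
  induction p using Polynomial.induction_on' with
  | add p q hp hq => simp [hp, hq]
  | monomial n a =>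
    rw [Polynomial.derivative_monomial]
    simp only [← Polynomial.C_mul_X_pow_eq_monomial, map_mul, map_pow, txEmb_C, txEmb_X,
      Derivation.leibniz, Derivation.leibniz_pow, xDeriv_C_T, tEmb_apply, xDeriv_map, map_natCast]
    simp
    ring

/-- Coefficientwise differentiation of a polynomial in `R[t][x]` with respect to `t`. -/
noncomputable def coeffDerivative (p : Polynomial (Polynomial R)) : Polynomial (Polynomial R) :=
  ∑ i ∈ Finset.range (p.natDegree + 1),
    Polynomial.monomial i (Polynomial.derivative (p.coeff i))

lemma natDegree_coeffDerivative_le (p : Polynomial (Polynomial R)) :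
    (coeffDerivative p).natDegree ≤ p.natDegree :=
  Polynomial.natDegree_sum_le_of_forall_le _ _ fun _ hi =>
    (Polynomial.natDegree_monomial_le _).trans (Nat.lt_succ_iff.1 (Finset.mem_range.1 hi))

lemma derivative_txEmb (p : Polynomial (Polynomial R)) :
    derivative _ (txEmb R p) = txEmb R (coeffDerivative p) := by
  conv_lhs => rw [p.as_sum_range]
  rw [coeffDerivative, map_sum, map_sum, map_sum]
  refine Finset.sum_congr rfl fun i _ => ?_
  simp only [← Polynomial.C_mul_X_pow_eq_monomial, map_mul, map_pow, txEmb_C, txEmb_X,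
    Derivation.leibniz, Derivation.leibniz_pow, tEmb_apply, derivative_map, derivative_C,
    ← derivative_coe]
  simp
  ring

end LaurentDerivative

section Holonomic

variable {R : Type*} [CommRing R]

/-- `DenomForm c D s N g` says that `D ^ N * g = p + q * s` with `p`, `q` in `R[t][x]` of degree
at most `c * N` in `x`. -/
def DenomForm (c : ℕ) (D : Polynomial (Polynomial R)) (s : PowerSeries R[T;T⁻¹]) (N : ℕ)
    (g : PowerSeries R[T;T⁻¹]) : Prop :=
  ∃ p q : Polynomial (Polynomial R), p.natDegree ≤ c * N ∧ q.natDegree ≤ c * N ∧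
    txEmb R D ^ N * g = txEmb R p + txEmb R q * s

variable {c : ℕ} {D σ : Polynomial (Polynomial R)} {s g : PowerSeries R[T;T⁻¹]} {N : ℕ}

lemma DenomForm.mono_succ (hD : D.natDegree ≤ c) (h : DenomForm c D s N g) :
    DenomForm c D s (N + 1) g := by
  obtain ⟨p, q, hp, hq, e⟩ := h
  refine ⟨D * p, D * q, ?_, ?_, ?_⟩
  · exact Polynomial.natDegree_mul_le.trans (by rw [mul_add]; lia)
  · exact Polynomial.natDegree_mul_le.trans (by rw [mul_add]; lia)
  · rw [map_mul, map_mul]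
    linear_combination txEmb R D * e

lemma DenomForm.mono (hD : D.natDegree ≤ c) {M : ℕ} (hNM : N ≤ M) (h : DenomForm c D s N g) :
    DenomForm c D s M g := by
  induction hNM with
  | refl => exact h
  | step _ ih => exact ih.mono_succ hD

lemma DenomForm.derivation {A : Type*} [CommRing A] [Algebra A (PowerSeries R[T;T⁻¹])]
    (d : Derivation A (PowerSeries R[T;T⁻¹]) (PowerSeries R[T;T⁻¹]))
    (δ : Polynomial (Polynomial R) → Polynomial (Polynomial R))
    (hδ : ∀ p, (δ p).natDegree ≤ p.natDegree) (hd : ∀ p, d (txEmb R p) = txEmb R (δ p))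
    (hD : D.natDegree ≤ c) (hσ : σ.natDegree ≤ c) (hs : txEmb R D * d s = txEmb R σ * s)
    (h : DenomForm c D s N g) : DenomForm c D s (N + 1) (d g) := by
  obtain ⟨p, q, hp, hq, e⟩ := h
  have hmul (u v : Polynomial (Polynomial R)) (hu : u.natDegree ≤ c) (hv : v.natDegree ≤ c * N) :
      (u * v).natDegree ≤ c * (N + 1) :=
    Polynomial.natDegree_mul_le.trans (by rw [mul_add]; lia)
  have hmul' (v : Polynomial (Polynomial R)) (hv : v.natDegree ≤ c * N) :
      ((N : Polynomial (Polynomial R)) * (δ D * v)).natDegree ≤ c * (N + 1) := by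
    refine Polynomial.natDegree_mul_le.trans ?_
    rw [Polynomial.natDegree_natCast, zero_add]
    exact hmul _ _ ((hδ D).trans hD) hv
  refine ⟨D * δ p - N * (δ D * p), D * δ q + σ * q - N * (δ D * q), ?_, ?_, ?_⟩
  · exact (Polynomial.natDegree_sub_le_of_le (hmul _ _ hD ((hδ p).trans hp)) (hmul' _ hp)).trans
      (max_self _).le
  · refine (Polynomial.natDegree_sub_le_of_le ?_ (hmul' _ hq)).trans (max_self _).le
    exact Polynomial.natDegree_add_le_of_degree_le (hmul _ _ hD ((hδ q).trans hq)) (hmul _ _ hσ hq)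
  · have e' := congrArg d e
    simp only [Derivation.leibniz, map_add, hd, smul_eq_mul] at e'
    have hpow : txEmb R D * d (txEmb R D ^ N) = N * (txEmb R (δ D) * txEmb R D ^ N) := by
      cases N with
      | zero => simp
      | succ n =>
        rw [Derivation.leibniz_pow, hd, nsmul_eq_mul, smul_eq_mul, Nat.add_sub_cancel]
        ring
    simp only [map_sub, map_add, map_mul, map_natCast]
    linear_combination txEmb R D * e' - g * hpow + txEmb R q * hs - N * txEmb R (δ D) * e

lemma DenomForm.iterate {d : PowerSeries R[T;T⁻¹] → PowerSeries R[T;T⁻¹]}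
    (hd : ∀ N g, DenomForm c D s N g → DenomForm c D s (N + 1) (d g))
    (h : DenomForm c D s N g) (j : ℕ) : DenomForm c D s (N + j) (d^[j] g) := by
  induction j with
  | zero => exact h
  | succ j ih => rw [Function.iterate_succ_apply']; exact hd _ _ ih

/-- Elements sharing a common denominator are linearly dependent over `R[t]` as soon as there
are more of them than the number of available monomials. -/
lemma exists_tEmb_relation [IsDomain R] (hD0 : txEmb R D ≠ 0) {ι : Type*} [Fintype ι]
    (g : ι → PowerSeries R[T;T⁻¹]) (hg : ∀ i, DenomForm c D s N (g i))
    (hcard : 2 * (c * N + 1) < Fintype.card ι) :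
    ∃ v : ι → Polynomial R, v ≠ 0 ∧ ∑ i, tEmb R (v i) * g i = 0 := by
  choose p q hp hq e using hg
  let L : (ι → Polynomial R) →ₗ[Polynomial R] (Fin 2 × Fin (c * N + 1) → Polynomial R) :=
    LinearMap.pi fun k => ∑ i, (if k.1 = 0 then (p i).coeff k.2 else (q i).coeff k.2) •
      LinearMap.proj i
  have hL : ¬ Function.Injective L := fun hinj => by
    have := card_le_of_injective _ L hinj
    simp only [Fintype.card_prod, Fintype.card_fin] at this
    lia
  rw [injective_iff_map_eq_zero] at hL
  push Not at hL
  obtain ⟨v, hv, hv0⟩ := hL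
  have hsum (w : ι → Polynomial (Polynomial R)) (hw : ∀ i, (w i).natDegree ≤ c * N)
      (hw' : ∀ k : Fin (c * N + 1), ∑ i, (w i).coeff k * v i = 0) :
      ∑ i, Polynomial.C (v i) * w i = 0 := by
    ext1 k
    rw [Polynomial.finsetSum_coeff, Polynomial.coeff_zero]
    rcases lt_or_ge k (c * N + 1) with hk | hk
    · rw [← hw' ⟨k, hk⟩]
      exact Finset.sum_congr rfl fun i _ => by rw [Polynomial.coeff_C_mul, mul_comm]
    · refine Finset.sum_eq_zero fun i _ => ?_
      rw [Polynomial.coeff_C_mul, Polynomial.coeff_eq_zero_of_natDegree_lt (by grind), mul_zero]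
  have hps := hsum p hp fun k => by simpa [L] using congrFun hv (0, k)
  have hqs := hsum q hq fun k => by simpa [L] using congrFun hv (1, k)
  refine ⟨v, hv0, (mul_eq_zero.1 ?_).resolve_left (pow_ne_zero N hD0)⟩
  calc txEmb R D ^ N * ∑ i, tEmb R (v i) * g i
      = ∑ i, txEmb R (Polynomial.C (v i)) * (txEmb R D ^ N * g i) := by
        rw [Finset.mul_sum]
        exact Finset.sum_congr rfl fun i _ => by rw [txEmb_C]; ring
    _ = txEmb R (∑ i, Polynomial.C (v i) * p i) + txEmb R (∑ i, Polynomial.C (v i) * q i) * s := by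
        simp only [map_sum, map_mul, Finset.sum_mul, ← Finset.sum_add_distrib]
        exact Finset.sum_congr rfl fun i _ => by rw [e]; ring
    _ = 0 := by rw [hps, hqs]; simp

/-- The residue in `x` of a series lying in a rank two holonomic module is D-finite in `t`. -/
theorem isDFinite_residue [IsDomain R] [CharZero R] {σx σt : Polynomial (Polynomial R)}
    {f : PowerSeries R[T;T⁻¹]} (hD0 : txEmb R D ≠ 0) (hx : txEmb R D * xDeriv R s = txEmb R σx * s)
    (ht : txEmb R D * derivative _ s = txEmb R σt * s)
    (hf : ∃ p q, txEmb R D * f = txEmb R p + txEmb R q * s) :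
    IsDFinite (xCoeff (-1) f) := by
  obtain ⟨p, q, hf⟩ := hf
  obtain ⟨c, hD, hσx, hσt, hp, hq⟩ : ∃ c, D.natDegree ≤ c ∧ σx.natDegree ≤ c ∧
      σt.natDegree ≤ c ∧ p.natDegree ≤ c ∧ q.natDegree ≤ c :=
    ⟨D.natDegree + σx.natDegree + σt.natDegree + p.natDegree + q.natDegree,
      by lia, by lia, by lia, by lia, by lia⟩
  have hf1 : DenomForm c D s 1 f := ⟨p, q, by lia, by lia, by rw [pow_one]; exact hf⟩
  have hdt (N g) (h : DenomForm c D s N g) : DenomForm c D s (N + 1) (derivative _ g) :=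
    h.derivation _ coeffDerivative natDegree_coeffDerivative_le derivative_txEmb hD hσt ht
  have hdx (N g) (h : DenomForm c D s N g) : DenomForm c D s (N + 1) (xDeriv R g) :=
    h.derivation _ Polynomial.derivative
      (fun p => (Polynomial.natDegree_derivative_le p).trans (Nat.sub_le _ _))
      xDeriv_txEmb hD hσx hx
  set M := 4 * c + 2 with hM
  obtain ⟨v, hv0, hv⟩ := exists_tEmb_relation (c := c) (N := 1 + M + M) (s := s) hD0
    (fun i : Fin (M + 1) × Fin (M + 1) => (xDeriv R)^[(i.2 : ℕ)] ((derivative _)^[(i.1 : ℕ)] f))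
    (fun i => ((hf1.iterate hdt i.1).iterate hdx i.2).mono hD (by lia))
    (by simp only [Fintype.card_prod, Fintype.card_fin]; rw [hM]; ring_nf; nlinarith)
  obtain ⟨⟨j₀, k₀⟩, hjk⟩ := Function.ne_iff.1 hv0
  let P (k : Fin (M + 1)) : Prop := ∃ j, v (j, k) ≠ 0
  obtain ⟨m, hm, hmin⟩ : ∃ m, P m ∧ ∀ k < m, ¬ P k := by
    obtain ⟨m, hm⟩ := (Set.toFinite {k | P k}).exists_minimal ⟨k₀, j₀, hjk⟩
    exact ⟨m, hm.prop, fun k hk hP => absurd (hm.le_of_le hP hk.le) (not_le.2 hk)⟩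
  refine ⟨M, fun j => v (j, m), hm, ?_⟩
  have key := congrArg (xCoeff (-1 - (m : ℕ))) hv
  rw [map_sum, map_zero, Fintype.sum_prod_type_right, Finset.sum_eq_single m] at key
  · simp only [tEmb_apply, xCoeff_map_mul, xCoeff_iterate_xDeriv, mul_smul_comm,
      ← Finset.smul_sum] at key
    have hprod : ((∏ i ∈ Finset.range (m : ℕ), (-1 - ((m : ℕ) : ℤ) + 1 + i) : ℤ) : R) ≠ 0 := by
      rw [Int.cast_ne_zero, Finset.prod_ne_zero_iff]
      intro i hi
      have := Finset.mem_range.1 hi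
      lia
    rw [PowerSeries.smul_eq_C_mul] at key
    have key' := (mul_eq_zero.1 key).resolve_left
      ((map_ne_zero_iff _ PowerSeries.C_injective).2 hprod)
    simp only [sub_add_cancel, xCoeff_iterate_derivative] at key'
    exact key'
  · intro k _ hk
    rcases lt_or_gt_of_ne hk with hlt | hgt
    · refine Finset.sum_eq_zero fun j _ => ?_
      have : v (j, k) = 0 := by_contra fun h => hmin k hlt ⟨j, h⟩
      simp [this]
    · refine Finset.sum_eq_zero fun j _ => ?_
      rw [tEmb_apply, xCoeff_map_mul, xCoeff_iterate_xDeriv,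
        Finset.prod_eq_zero (Finset.mem_range.2 (Fin.lt_def.1 hgt)) (by ring), Int.cast_zero,
        zero_smul, mul_zero]
  · simp

end Holonomic

section Walks

/-- The quarter-plane neighbours of a point for the steps of Model 18. -/
def nbrs : ℕ × ℕ → Finset (ℕ × ℕ)
  | (0, 0) => {(1, 0), (0, 1)}
  | (i + 1, 0) => {(i + 2, 0), (i + 1, 1), (i, 0), (i, 1)}
  | (0, j + 1) => {(1, j + 1), (0, j + 2), (0, j), (1, j)}
  | (i + 1, j + 1) =>
    {(i + 2, j + 1), (i + 1, j + 2), (i, j + 1), (i, j + 2), (i + 1, j), (i + 2, j)}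

/-- The step set of Model 18. -/
abbrev model18Steps : Set (ℤ × ℤ) :=
  {((1 : ℤ), (0 : ℤ)), (-1, 0), (0, 1), (0, -1), (1, -1), (-1, 1)}

lemma mem_nbrs (p q : ℕ × ℕ) :
    q ∈ nbrs p ↔ ((q.1 : ℤ) - (p.1 : ℤ), (q.2 : ℤ) - (p.2 : ℤ)) ∈ model18Steps := by
  obtain ⟨_ | i, _ | j⟩ := p <;> obtain ⟨k, l⟩ := q <;>
    simp only [nbrs, model18Steps, Finset.mem_insert, Finset.mem_singleton, Set.mem_insert_iff,
      Set.mem_singleton_iff, Prod.mk.injEq] <;> push_cast <;> lia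

/-- The walks of length `n` starting at `p`. -/
def walks : (n : ℕ) → ℕ × ℕ → Finset (Fin (n + 1) → ℕ × ℕ)
  | 0, p => {fun _ => p}
  | n + 1, p => (nbrs p).biUnion fun q => (walks n q).image (Fin.cons p)

lemma mem_walks {n : ℕ} {p : ℕ × ℕ} {w : Fin (n + 1) → ℕ × ℕ} :
    w ∈ walks n p ↔ w 0 = p ∧ ∀ i : Fin n, w i.succ ∈ nbrs (w i.castSucc) := by
  induction n generalizing p with
  | zero =>
    simp only [walks, Finset.mem_singleton, IsEmpty.forall_iff, and_true]
    exact ⟨fun h => by rw [h], fun h => funext fun i => by rw [show i = 0 from Fin.ext (by lia), h]⟩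
  | succ n ih =>
    simp only [walks, Finset.mem_biUnion, Finset.mem_image, ih, Fin.forall_fin_succ (n := n)]
    constructor
    · rintro ⟨q, hq, w', ⟨rfl, hw⟩, rfl⟩
      exact ⟨rfl, by simpa using hq, fun i => by simpa [← Fin.succ_castSucc] using hw i⟩
    · rintro ⟨rfl, h0, h⟩
      refine ⟨w 1, by simpa using h0, Fin.tail w, ⟨rfl, fun i => ?_⟩, Fin.cons_self_tail w⟩
      simpa [Fin.tail, ← Fin.succ_castSucc] using h i

lemma hvisits_cons {n : ℕ} (p : ℕ × ℕ) (w : Fin (n + 1) → ℕ × ℕ) :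
    hvisits (Fin.cons p w : Fin (n + 2) → ℕ × ℕ) = (if (w 0).2 = 0 then 1 else 0) + hvisits w := by
  simp only [hvisits, Finset.card_filter]
  rw [Fin.sum_univ_succ, Fin.sum_univ_succ, Fin.sum_univ_succ (n := n)]
  simp

lemma vvisits_cons {n : ℕ} (p : ℕ × ℕ) (w : Fin (n + 1) → ℕ × ℕ) :
    vvisits (Fin.cons p w : Fin (n + 2) → ℕ × ℕ) = (if (w 0).1 = 0 then 1 else 0) + vvisits w := by
  simp only [vvisits, Finset.card_filter]
  rw [Fin.sum_univ_succ, Fin.sum_univ_succ, Fin.sum_univ_succ (n := n)]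
  simp

variable {A : Type*} [CommRing A]

/-- The interaction weight of a vertex. -/
def vertexWeight (a : A) (q : ℕ × ℕ) : A :=
  a ^ (if q.2 = 0 then 1 else 0) * a ^ (if q.1 = 0 then 1 else 0)

/-- The transfer operator of the interacting model, acting on observables of the end point. -/
def transfer (a : A) (φ : ℕ × ℕ → A) (p : ℕ × ℕ) : A :=
  ∑ q ∈ nbrs p, vertexWeight a q * φ q

lemma sum_walks_succ {n : ℕ} (p : ℕ × ℕ) (F : (Fin (n + 2) → ℕ × ℕ) → A) :
    ∑ w ∈ walks (n + 1) p, F w = ∑ q ∈ nbrs p, ∑ w ∈ walks n q, F (Fin.cons p w) := by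
  rw [walks, Finset.sum_biUnion]
  · exact Finset.sum_congr rfl fun q _ =>
      Finset.sum_image fun _ _ _ _ h => Fin.cons_right_injective (α := fun _ => ℕ × ℕ) p h
  · intro q _ q' _ hne
    rw [Function.onFun, Finset.disjoint_left]
    rintro w hw hw'
    obtain ⟨v, hv, rfl⟩ := Finset.mem_image.1 hw
    obtain ⟨v', hv', h⟩ := Finset.mem_image.1 hw'
    obtain rfl : v' = v := Fin.cons_right_injective (α := fun _ => ℕ × ℕ) p h
    exact hne ((mem_walks.1 hv).1.symm.trans (mem_walks.1 hv').1)

lemma sum_walks_eq_iterate_transfer (a : A) (φ : ℕ × ℕ → A) (n : ℕ) (p : ℕ × ℕ) :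
    ∑ w ∈ walks n p, a ^ hvisits w * a ^ vvisits w * φ (w (Fin.last n)) =
      (transfer a)^[n] φ p := by
  induction n generalizing p with
  | zero => simp [walks, hvisits, vvisits]
  | succ n ih =>
    rw [sum_walks_succ, Function.iterate_succ_apply', transfer]
    refine Finset.sum_congr rfl fun q _ => ?_
    rw [← ih, Finset.mul_sum]
    refine Finset.sum_congr rfl fun w hw => ?_
    rw [hvisits_cons, vvisits_cons, (mem_walks.1 hw).1, vertexWeight, pow_add, pow_add,
      ← Fin.succ_last, Fin.cons_succ]
    ring

/-- The indicator of the point `p`. -/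
def pointInd (A : Type*) [CommRing A] (p q : ℕ × ℕ) : A := if q = p then 1 else 0

lemma loopGF_model18 (a : A) :
    loopGF model18Steps a a =
      PowerSeries.mk fun n => (transfer a)^[n] (pointInd A (0, 0)) (0, 0) := by
  classical
  ext n
  rw [loopGF, coeff_mk, coeff_mk, ← sum_walks_eq_iterate_transfer]
  have hset : {w : Fin (n + 1) → ℕ × ℕ | IsQPLoop model18Steps n w} =
      ↑((walks n (0, 0)).filter fun w => w (Fin.last n) = (0, 0)) := by
    ext w
    simp only [Set.mem_ofPred_eq, IsQPLoop, Finset.coe_filter, mem_walks, mem_nbrs]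
    tauto
  have h := finsum_set_coe_eq_finsum_mem {w : Fin (n + 1) → ℕ × ℕ | IsQPLoop model18Steps n w}
    (f := fun w => a ^ hvisits w * a ^ vvisits w)
  refine h.trans ?_
  rw [hset, finsum_mem_coe_finset, Finset.sum_filter]
  exact Finset.sum_congr rfl fun w _ => by simp [pointInd]

lemma map_iterate_transfer {A' : Type*} [CommRing A'] {a : A} {a' : A'} (f : A →+ A')
    (hf : ∀ m, f (a * m) = a' * f m) (φ : ℕ × ℕ → A) (n : ℕ) (p : ℕ × ℕ) :
    f ((transfer a)^[n] φ p) = (transfer a')^[n] (fun q => f (φ q)) p := by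
  induction n generalizing p with
  | zero => rfl
  | succ n ih =>
    simp only [Function.iterate_succ_apply', transfer, map_sum, ← ih]
    refine Finset.sum_congr rfl fun q _ => ?_
    unfold vertexWeight
    split_ifs <;> simp [mul_assoc, hf]

lemma transfer_add (a : A) (φ ψ : ℕ × ℕ → A) :
    transfer a (φ + ψ) = transfer a φ + transfer a ψ := by
  ext p
  simp [transfer, mul_add, Finset.sum_add_distrib]

lemma transfer_smul (a b : A) (φ : ℕ × ℕ → A) : transfer a (b • φ) = b • transfer a φ := by
  ext p
  simp only [transfer, Pi.smul_apply, smul_eq_mul, Finset.mul_sum]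
  exact Finset.sum_congr rfl fun q _ => by ring

lemma iterate_transfer_add (a : A) (φ ψ : ℕ × ℕ → A) (n : ℕ) :
    (transfer a)^[n] (φ + ψ) = (transfer a)^[n] φ + (transfer a)^[n] ψ := by
  induction n with
  | zero => rfl
  | succ n ih => simp only [Function.iterate_succ_apply', ih, transfer_add]

lemma iterate_transfer_smul (a b : A) (φ : ℕ × ℕ → A) (n : ℕ) :
    (transfer a)^[n] (b • φ) = b • (transfer a)^[n] φ := by
  induction n with
  | zero => rfl
  | succ n ih => simp only [Function.iterate_succ_apply', ih, transfer_smul]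

lemma nbrs_swap (p : ℕ × ℕ) : nbrs p.swap = (nbrs p).map (Equiv.prodComm ℕ ℕ).toEmbedding := by
  ext q
  rw [Finset.mem_map_equiv, mem_nbrs, mem_nbrs]
  simp only [model18Steps, Equiv.prodComm_symm, Equiv.prodComm_apply, Prod.fst_swap, Prod.snd_swap,
    Set.mem_insert_iff, Set.mem_singleton_iff, Prod.mk.injEq]
  lia

lemma iterate_transfer_swap (a : A) (φ : ℕ × ℕ → A) (n : ℕ) (p : ℕ × ℕ) :
    (transfer a)^[n] (fun q => φ q.swap) p = (transfer a)^[n] φ p.swap := by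
  induction n generalizing p with
  | zero => rfl
  | succ n ih =>
    simp only [Function.iterate_succ_apply', transfer, nbrs_swap, Finset.sum_map, ih]
    exact Finset.sum_congr rfl fun q _ => congrArg (· * _) (mul_comm _ _)

/-- The observable `x ^ i` on the horizontal boundary. -/
def horizontalMonomial (x : A) (p : ℕ × ℕ) : A := if p.2 = 0 then x ^ p.1 else 0

/-- The combination of observables whose weighted version is the monomial
`a ^ 2 * x ^ i * y ^ j`. -/
def unweightedMonomial (a x y : A) : ℕ × ℕ → A :=
  a ^ 2 • (fun p => x ^ p.1 * y ^ p.2) + (a - a ^ 2) • horizontalMonomial x +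
    (a - a ^ 2) • (fun p => horizontalMonomial y p.swap) + (a - 1) ^ 2 • pointInd A (0, 0)

lemma vertexWeight_mul_unweightedMonomial (a x y : A) (q : ℕ × ℕ) :
    vertexWeight a q * unweightedMonomial a x y q = a ^ 2 * (x ^ q.1 * y ^ q.2) := by
  obtain ⟨_ | i, _ | j⟩ := q <;>
    simp [vertexWeight, unweightedMonomial, horizontalMonomial, pointInd] <;> ring

lemma transfer_unweightedMonomial (a x y : A) :
    (x * y) • transfer a (unweightedMonomial a x y) =
      (a ^ 2 * (x ^ 2 * y + y + x * y ^ 2 + x + x ^ 2 + y ^ 2)) • (fun p => x ^ p.1 * y ^ p.2) +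
      (-(a ^ 2 * (x * (1 + x)))) • horizontalMonomial x +
      (-(a ^ 2 * (y * (1 + y)))) • (fun p => horizontalMonomial y p.swap) := by
  ext p
  simp only [Pi.smul_apply, Pi.add_apply, smul_eq_mul, transfer,
    vertexWeight_mul_unweightedMonomial]
  obtain ⟨_ | i, _ | j⟩ := p <;> simp [nbrs, horizontalMonomial] <;> ring

end Walks

section Collapse

variable {A : Type*} [CommRing A]

/-- The sum `∑ Xⁿ gₙ`. -/
noncomputable def collapse (g : ℕ → PowerSeries A) : PowerSeries A :=
  PowerSeries.mk fun m => ∑ n ∈ Finset.range (m + 1), coeff (m - n) (g n)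

lemma coeff_collapse (g : ℕ → PowerSeries A) {m M : ℕ} (h : m < M) :
    coeff m (collapse g) = coeff m (∑ n ∈ Finset.range M, X ^ n * g n) := by
  rw [collapse, coeff_mk, map_sum]
  refine (Finset.sum_congr rfl fun n hn => ?_).trans
    (Finset.sum_subset (Finset.range_subset_range.2 h) fun n _ hn => ?_)
  · rw [coeff_X_pow_mul', if_pos (by simpa [Nat.lt_succ_iff] using hn)]
  · rw [coeff_X_pow_mul', if_neg (by simpa [Nat.lt_succ_iff] using hn)]

lemma collapse_add (g h : ℕ → PowerSeries A) :
    collapse (fun n => g n + h n) = collapse g + collapse h := by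
  ext m
  simp [collapse, Finset.sum_add_distrib]

lemma collapse_mul_left (b : PowerSeries A) (g : ℕ → PowerSeries A) :
    collapse (fun n => b * g n) = b * collapse g := by
  ext m
  rw [coeff_collapse _ m.lt_succ_self, coeff_mul]
  have : ∀ p ∈ Finset.HasAntidiagonal.antidiagonal m, coeff p.1 b * coeff p.2 (collapse g) =
      coeff p.1 b * coeff p.2 (∑ n ∈ Finset.range (m + 1), X ^ n * g n) := fun p hp => by
    rw [coeff_collapse g (Nat.lt_succ_of_le (Finset.HasAntidiagonal.antidiagonal.snd_le hp))]
  rw [Finset.sum_congr rfl this, ← coeff_mul, Finset.mul_sum]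
  exact congrArg _ (Finset.sum_congr rfl fun n _ => by ring)

lemma collapse_succ (g : ℕ → PowerSeries A) :
    collapse g = g 0 + X * collapse fun n => g (n + 1) := by
  ext m
  rw [coeff_collapse _ m.lt_succ_self, Finset.sum_range_succ', add_comm, map_add, map_add,
    pow_zero, one_mul]
  congr 1
  cases m with
  | zero => simp
  | succ m =>
    rw [coeff_succ_X_mul, coeff_collapse _ m.lt_succ_self, ← coeff_succ_X_mul (n := m),
      Finset.mul_sum]
    exact congrArg _ (Finset.sum_congr rfl fun n _ => by ring)

lemma collapse_C (c : ℕ → A) : collapse (fun n => C (c n)) = PowerSeries.mk c := by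
  ext m
  rw [collapse, coeff_mk, coeff_mk, Finset.sum_eq_single m]
  · simp
  · intro n hn hne
    rw [coeff_C, if_neg]
    have := Finset.mem_range.1 hn
    lia
  · simp

/-- The generating function, by length, of the walks from the origin, weighted by `φ`. -/
noncomputable def walkGF (a : PowerSeries A) (φ : ℕ × ℕ → PowerSeries A) : PowerSeries A :=
  collapse fun n => (transfer a)^[n] φ (0, 0)

variable (a : PowerSeries A) (φ ψ : ℕ × ℕ → PowerSeries A)

lemma walkGF_add : walkGF a (φ + ψ) = walkGF a φ + walkGF a ψ := by
  simp only [walkGF, iterate_transfer_add, Pi.add_apply, collapse_add]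

lemma walkGF_smul (b : PowerSeries A) : walkGF a (b • φ) = b * walkGF a φ := by
  simp only [walkGF, iterate_transfer_smul, Pi.smul_apply, smul_eq_mul, collapse_mul_left]

lemma walkGF_eq : walkGF a φ = φ (0, 0) + X * walkGF a (transfer a φ) :=
  collapse_succ _

lemma walkGF_swap : walkGF a (fun p => φ p.swap) = walkGF a φ := by
  simp only [walkGF, iterate_transfer_swap, Prod.swap_prod_mk]

lemma walkGF_C (a : A) (φ : ℕ × ℕ → A) :
    walkGF (C a) (fun p => C (φ p)) = PowerSeries.mk fun n => (transfer a)^[n] φ (0, 0) := by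
  rw [← collapse_C]
  simp only [walkGF]
  exact congrArg collapse (funext fun n =>
    (map_iterate_transfer (a := a) (a' := C a) (C : A →+* PowerSeries A).toAddMonoidHom
      (fun m => map_mul C _ _) φ n _).symm)

/-- The functional equation of the model on the kernel curve. -/
lemma walkGF_kernel_equation {x y : PowerSeries A}
    (h : x * y = X * (x ^ 2 * y + y + x * y ^ 2 + x + x ^ 2 + y ^ 2)) :
    x * y * ((a - a ^ 2) * (walkGF a (horizontalMonomial x) + walkGF a (horizontalMonomial y)) +
        (a - 1) ^ 2 * walkGF a (pointInd _ (0, 0)) - 1) +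
      a ^ 2 * X * (x * (1 + x) * walkGF a (horizontalMonomial x) +
        y * (1 + y) * walkGF a (horizontalMonomial y)) = 0 := by
  have h1 := congrArg (x * y * ·) (walkGF_eq a (unweightedMonomial a x y))
  have h2 := congrArg (walkGF a) (transfer_unweightedMonomial a x y)
  have h3 : unweightedMonomial a x y (0, 0) = 1 := by
    simp [unweightedMonomial, horizontalMonomial, pointInd]; ring
  simp only [walkGF_smul, walkGF_add, walkGF_swap a (horizontalMonomial y)] at h2
  rw [h3] at h1
  simp only [unweightedMonomial] at h1 h2
  simp only [walkGF_smul, walkGF_add, walkGF_swap a (horizontalMonomial y)] at h1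
  linear_combination h1 + X * h2 - a ^ 2 * walkGF a (fun p => x ^ p.1 * y ^ p.2) * h

end Collapse

section KernelRoot

variable {A : Type*} [CommRing A]

lemma exists_catalan_equation {w : PowerSeries A} (hw : constantCoeff w = 0) :
    ∃ c : PowerSeries A, c = 1 + w * c ^ 2 := by
  have hs : HasSubst w := HasSubst.of_constantCoeff_zero' hw
  have h := congrArg (PowerSeries.map (Int.castRingHom A))
    (congrArg (PowerSeries.map (Nat.castRingHom ℤ)) catalanSeries_sq_mul_X_add_one)
  simp only [map_add, map_mul, map_pow, map_one, PowerSeries.map_X] at h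
  have h' := congrArg (substAlgHom (R := A) hs) h
  simp only [map_add, map_mul, map_pow, map_one, substAlgHom_X] at h'
  exact ⟨_, h'.symm.trans (by ring)⟩

lemma exists_quadratic_root {b w : PowerSeries A} (hb : constantCoeff b = 1)
    (hw : constantCoeff w = 0) : ∃ u : PowerSeries A, b * u = 1 + w * u ^ 2 := by
  have hi : b * invOfUnit b 1 = 1 := mul_invOfUnit b 1 hb
  obtain ⟨c, hc⟩ := exists_catalan_equation (w := invOfUnit b 1 ^ 2 * w) (by simp [hw])
  exact ⟨invOfUnit b 1 * c, by linear_combination hc + c * hi⟩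

end KernelRoot

section KernelCurve

variable {B : Type*} [CommRing B] {t x xi v y a : B}

/-- `y` is the small root of the kernel of Model 18 over `x`, with inverse `v / (t * (1 + x))`. -/
structure IsKernelRoot (t x xi v y : B) : Prop where
  mul_inv : x * xi = 1
  mul_eq : v * y = t * (1 + x)
  add_eq : v + t * (1 + xi) * y = 1 - t * (x + xi)

/-- The coefficient of the boundary series in the equation obtained by elimination. -/
def boundaryPoly (a t x : B) : B :=
  (a - 1) * (a - 1 + a * t) + (1 - a - 2 * a * (a - 1) * t) * x + a * t * (1 + 2 * a * t) * x ^ 2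

/-- The coefficient of the excursion series in the equation obtained by elimination. -/
def boundaryNum (a t x xi y : B) : B :=
  boundaryPoly a t x + x * boundaryPoly a t xi -
    (1 + x) * (a - 1 - a * t * (1 + y) * xi) * (a - 1 - a * t * (x + y))

namespace IsKernelRoot

lemma mul_eq_boundaryPoly (h : IsKernelRoot t x xi v y) (a : B) :
    ((1 + x) * (a - 1) - a * v * x * (1 + y)) * (a - 1 - a * t * (x + y)) =
      boundaryPoly a t x := by
  unfold boundaryPoly
  linear_combination (-a * x * (a - 1 - a * t * (x + y)) + a ^ 2 * t * x) * h.mul_eq -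
    a * (a - 1 - a * t * x) * x * h.add_eq + a * (a - 1 - a * t * x) * t * (1 + y) * h.mul_inv

lemma mul_eq_boundaryPoly_inv (h : IsKernelRoot t x xi v y) (a : B) :
    (a - 1 - a * t * (1 + y) * xi) * ((1 + x) * (a - 1) - a * v * (1 + xi * y)) =
      x * boundaryPoly a t xi := by
  unfold boundaryPoly
  linear_combination (-a * xi * (a - 1 - a * t * (1 + y) * xi) + a ^ 2 * t * xi) * h.mul_eq -
    a * (a - 1 - a * t * xi) * h.add_eq +
    (-a * t * (a - 1 - a * t * xi) * y - 2 * (a - 1) * a * t + a ^ 2 * t ^ 2 * xi -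
      (1 - a - 2 * a * (a - 1) * t) - a * t * (1 + 2 * a * t) * xi) * h.mul_inv

lemma kernel (h : IsKernelRoot t x xi v y) :
    x * y = t * (x ^ 2 * y + y + x * y ^ 2 + x + x ^ 2 + y ^ 2) := by
  linear_combination x * h.mul_eq - x * y * h.add_eq + t * (y + y ^ 2) * h.mul_inv

lemma kernel_mul_inv_left (h : IsKernelRoot t x xi v y) :
    y * xi * y =
      t * ((y * xi) ^ 2 * y + y + (y * xi) * y ^ 2 + y * xi + (y * xi) ^ 2 + y ^ 2) := by
  linear_combination y * xi * h.mul_eq - y ^ 2 * xi * h.add_eq + t * (y + y ^ 2) * h.mul_inv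

lemma kernel_mul_inv_inv (h : IsKernelRoot t x xi v y) :
    y * xi * xi =
      t * ((y * xi) ^ 2 * xi + xi + (y * xi) * xi ^ 2 + y * xi + (y * xi) ^ 2 + xi ^ 2) := by
  linear_combination xi ^ 2 * h.mul_eq - y * xi ^ 2 * h.add_eq + t * (xi * y + xi) * h.mul_inv

/-- Elimination of the auxiliary boundary values from the functional equation. -/
lemma boundary_equation [IsDomain B] (h : IsKernelRoot t x xi v y) (hy : y ≠ 0) {E : B}
    {ρ : B → B} (hρ : ∀ X Y, X * Y = t * (X ^ 2 * Y + Y + X * Y ^ 2 + X + X ^ 2 + Y ^ 2) →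
      X * Y * (a * (a - 1) * (ρ X + ρ Y) + E) =
        a ^ 2 * t * (X * (1 + X) * ρ X + Y * (1 + Y) * ρ Y)) :
    a * (a - 1 - a * v) * (boundaryPoly a t x * ρ x + x * boundaryPoly a t xi * ρ xi) =
      -(E * boundaryNum a t x xi y) := by
  have hx0 : x ≠ 0 := left_ne_zero_of_mul_eq_one h.mul_inv
  have hxi0 : xi ≠ 0 := right_ne_zero_of_mul_eq_one h.mul_inv
  have h1 : a * (a - 1 - a * v) * ρ x + a * (a - 1 - a * t * (1 + y) * xi) * ρ y + E = 0 := by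
    refine (mul_eq_zero_iff_left (mul_ne_zero hx0 hy)).1 ?_
    linear_combination hρ x y h.kernel - a ^ 2 * x * ρ x * h.mul_eq -
      a ^ 2 * t * y * (1 + y) * ρ y * h.mul_inv
  have h2 : a * ((1 + x) * (a - 1) - a * v * x * (1 + y)) * ρ y +
      a * ((1 + x) * (a - 1) - a * v * (1 + xi * y)) * ρ (y * xi) + (1 + x) * E = 0 := by
    refine (mul_eq_zero_iff_left (mul_ne_zero (pow_ne_zero 2 hy) hxi0)).1 ?_
    linear_combination (1 + x) * hρ (y * xi) y h.kernel_mul_inv_left -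
      (a ^ 2 * y * (1 + y) * ρ y + a ^ 2 * y * xi * (1 + y * xi) * ρ (y * xi)) * h.mul_eq -
      a ^ 2 * v * y ^ 2 * (1 + y) * ρ y * h.mul_inv
  have h3 : a * (a - 1 - a * t * (x + y)) * ρ (y * xi) + a * (a - 1 - a * v) * ρ xi + E = 0 := by
    refine (mul_eq_zero_iff_left (mul_ne_zero hy (pow_ne_zero 2 hxi0))).1 ?_
    linear_combination hρ (y * xi) xi h.kernel_mul_inv_inv - a ^ 2 * xi ^ 2 * ρ xi * h.mul_eq -
      (a ^ 2 * t * y * xi * ρ (y * xi) + a ^ 2 * t * xi * ρ xi) * h.mul_inv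
  unfold boundaryNum
  linear_combination boundaryPoly a t x * h1 -
    (a - 1 - a * t * (1 + y) * xi) * (a - 1 - a * t * (x + y)) * h2 +
    x * boundaryPoly a t xi * h3 +
    a * (a - 1 - a * t * (1 + y) * xi) * ρ y * h.mul_eq_boundaryPoly a +
    a * (a - 1 - a * t * (x + y)) * ρ (y * xi) * h.mul_eq_boundaryPoly_inv a

end IsKernelRoot

end KernelCurve

section Extraction

variable {R : Type*} [CommRing R]

lemma xCoeff_C_T_mul (k m : ℤ) (f : PowerSeries R[T;T⁻¹]) :
    xCoeff k (C (LaurentPolynomial.T m) * f) = xCoeff (k - m) f := by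
  ext n
  rw [coeff_xCoeff, coeff_xCoeff, coeff_C_mul]
  rw [LaurentPolynomial.T, AddMonoidAlgebra.coeff_single_mul_apply]
  rw [one_mul, neg_add_eq_sub]

lemma xCoeff_walkGF (a : R) (φ : ℕ × ℕ → R[T;T⁻¹]) (k : ℤ) :
    xCoeff k (walkGF (C (LaurentPolynomial.C a)) fun p => C (φ p)) =
      walkGF (C a) fun p => C ((φ p).coeff k) := by
  ext n
  rw [coeff_xCoeff, walkGF_C, walkGF_C, coeff_mk, coeff_mk]
  exact map_iterate_transfer (a := LaurentPolynomial.C a) (a' := a)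
    { toFun := fun p : R[T;T⁻¹] => p.coeff k, map_zero' := by simp, map_add' := by simp }
    (fun m => by rw [← LaurentPolynomial.smul_eq_C_mul]; rfl) φ n _

lemma map_pointInd {A A' : Type*} [CommRing A] [CommRing A'] (f : A →+* A') (p : ℕ × ℕ) :
    (fun q => f (pointInd A p q)) = pointInd A' p := by
  ext1 q
  unfold pointInd
  split_ifs <;> simp

lemma walkGF_pointInd_laurent (a : R) (p : ℕ × ℕ) :
    walkGF (C (LaurentPolynomial.C a)) (pointInd _ p) =
      PowerSeries.map LaurentPolynomial.C (walkGF (C a) (pointInd _ p)) := by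
  ext1 n
  rw [← map_pointInd (C : R →+* PowerSeries R),
    ← map_pointInd (C : R[T;T⁻¹] →+* PowerSeries R[T;T⁻¹]),
    walkGF_C, walkGF_C, coeff_map, coeff_mk, coeff_mk]
  rw [← map_pointInd (LaurentPolynomial.C : R →+* R[T;T⁻¹])]
  exact (map_iterate_transfer (a := a) (a' := LaurentPolynomial.C a)
    (LaurentPolynomial.C : R →+* R[T;T⁻¹]).toAddMonoidHom (fun m => map_mul LaurentPolynomial.C _ _)
    (pointInd R p) n _).symm

lemma horizontalMonomial_C_T (m : ℤ) :
    horizontalMonomial (C (LaurentPolynomial.T m) : PowerSeries R[T;T⁻¹]) =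
      fun p => C (if p.2 = 0 then LaurentPolynomial.T (p.1 * m) else 0) := by
  ext1 p
  unfold horizontalMonomial
  split_ifs
  · rw [← map_pow, LaurentPolynomial.T_pow]
  · simp

lemma xCoeff_walkGF_horizontalMonomial (a : R) {m k : ℤ} {φ : ℕ × ℕ → R}
    (h : ∀ p, φ p = if p.2 = 0 ∧ p.1 * m = k then 1 else 0) :
    xCoeff k (walkGF (C (LaurentPolynomial.C a)) (horizontalMonomial (C (LaurentPolynomial.T m)))) =
      walkGF (C a) fun p => C (φ p) := by
  rw [horizontalMonomial_C_T, xCoeff_walkGF]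
  congr 1
  ext1 p
  rw [h]
  by_cases h1 : p.2 = 0
  · simp only [h1, if_true, true_and]
    rw [LaurentPolynomial.T, AddMonoidAlgebra.coeff_single, Finsupp.single_apply]
  · simp [h1]

lemma walkGF_zero (a : R) : walkGF (C a) (fun _ => C 0) = 0 := by
  have := walkGF_smul (C a) (fun _ => 0) (0 : PowerSeries R)
  simpa [Pi.zero_def] using this

lemma walkGF_pointInd_zero (a : R) :
    walkGF (C a) (pointInd _ (0, 0)) = 1 + 2 * X * C a ^ 2 * walkGF (C a) (pointInd _ (1, 0)) := by
  have h : transfer (C a) (pointInd _ (0, 0)) = C a ^ 2 • pointInd (PowerSeries R) (1, 0) +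
      C a ^ 2 • fun p => pointInd _ (1, 0) p.swap := by
    ext1 ⟨i, j⟩
    rcases i with _ | _ | i <;> rcases j with _ | _ | j <;>
      simp [transfer, nbrs, pointInd, vertexWeight] <;> ring
  rw [walkGF_eq, h, walkGF_add, walkGF_smul, walkGF_smul, walkGF_swap _ (pointInd _ (1, 0))]
  simp only [pointInd, if_true]
  ring

end Extraction

section Excursions

variable {R : Type*} [CommRing R]

lemma one_add_T_ne_zero [Nontrivial R] :
    (1 + C (LaurentPolynomial.T 1) : PowerSeries R[T;T⁻¹]) ≠ 0 := by
  rw [← map_one C, ← map_add, Ne, map_eq_zero_iff _ C_injective]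
  intro h
  have := congrArg (fun p : R[T;T⁻¹] => p.coeff 0) h
  rw [← LaurentPolynomial.T_zero] at this
  simp only [LaurentPolynomial.T, AddMonoidAlgebra.coeff_add, Finsupp.add_apply,
    AddMonoidAlgebra.coeff_single, Finsupp.single_apply] at this
  simp at this

variable {v y : PowerSeries R[T;T⁻¹]}

lemma IsKernelRoot.exists_inv
    (h : IsKernelRoot X (C (LaurentPolynomial.T 1)) (C (LaurentPolynomial.T (-1))) v y) (a : R) :
    ∃ ia, (C (LaurentPolynomial.C a) - 1 - C (LaurentPolynomial.C a) * v) * ia = 1 := by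
  have hv := congrArg constantCoeff h.add_eq
  simp only [map_add, map_sub, map_mul, map_one, constantCoeff_X, zero_mul, add_zero,
    sub_zero] at hv
  have hα := mul_invOfUnit (-(C (LaurentPolynomial.C a) - 1 - C (LaurentPolynomial.C a) * v)) 1
    (by simp [hv])
  exact ⟨_, (mul_neg _ _).trans ((neg_mul _ _).symm.trans hα)⟩

variable [IsDomain R]

variable (R) in
lemma exists_isKernelRoot :
    ∃ v y : PowerSeries R[T;T⁻¹],
      IsKernelRoot X (C (LaurentPolynomial.T 1)) (C (LaurentPolynomial.T (-1))) v y ∧ y ≠ 0 := by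
  set x : PowerSeries R[T;T⁻¹] := C (LaurentPolynomial.T 1)
  set xi : PowerSeries R[T;T⁻¹] := C (LaurentPolynomial.T (-1))
  obtain ⟨u, hu⟩ := exists_quadratic_root (b := 1 - X * (x + xi))
    (w := X ^ 2 * (1 + x) * (1 + xi)) (by simp) (by simp)
  refine ⟨1 - X * (x + xi) - X ^ 2 * (1 + x) * (1 + xi) * u, X * (1 + x) * u, ⟨?_, ?_, ?_⟩, ?_⟩
  · rw [← map_mul, ← LaurentPolynomial.T_add]
    simp
  · linear_combination X * (1 + x) * hu
  · ring
  · refine mul_ne_zero (mul_ne_zero X_ne_zero one_add_T_ne_zero) ?_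
    rintro rfl
    simp at hu

/-- The excursion series as a quotient of two series that are affine in the coefficient of `x ^ 0`
of an algebraic series. -/
lemma IsKernelRoot.walkGF_equation
    (h : IsKernelRoot X (C (LaurentPolynomial.T 1)) (C (LaurentPolynomial.T (-1))) v y)
    (hy : y ≠ 0) (a : R) {ia : PowerSeries R[T;T⁻¹]}
    (hia : (C (LaurentPolynomial.C a) - 1 - C (LaurentPolynomial.C a) * v) * ia = 1)
    {τ : PowerSeries R} (hτ : τ = xCoeff 0 (boundaryNum (C (LaurentPolynomial.C a)) X
      (C (LaurentPolynomial.T 1)) (C (LaurentPolynomial.T (-1))) y * ia)) :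
    ((C a - 1) * (C a - 1 + C a * X) + 2 * X * C a ^ 2 * ((C a - 1) * (C a - 1 + C a * X) +
        (1 - C a - 2 * C a * (C a - 1) * X)) - 2 * X * C a * (C a - 1) ^ 2 * τ) *
      walkGF (C a) (pointInd _ (0, 0)) =
      (C a - 1) * (C a - 1 + C a * X) - 2 * X * C a * τ := by
  have hb := h.boundary_equation (a := C (LaurentPolynomial.C a)) hy
    (ρ := fun x => walkGF (C (LaurentPolynomial.C a)) (horizontalMonomial x))
    (E := 1 - (C (LaurentPolynomial.C a) - 1) ^ 2 *
      walkGF (C (LaurentPolynomial.C a)) (pointInd _ (0, 0)))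
    fun x y hxy => by
      linear_combination -walkGF_kernel_equation (C (LaurentPolynomial.C a)) hxy
  set ρ := walkGF (C (LaurentPolynomial.C a)) (horizontalMonomial (C (LaurentPolynomial.T 1)))
    with hρ
  set ρi := walkGF (C (LaurentPolynomial.C a)) (horizontalMonomial (C (LaurentPolynomial.T (-1))))
    with hρi
  set G := walkGF (C a) (pointInd _ (0, 0)) with hG
  set G₁ := walkGF (C a) (pointInd _ (1, 0)) with hG₁
  have r0 : xCoeff 0 ρ = G := by
    rw [hG, ← map_pointInd C]
    exact xCoeff_walkGF_horizontalMonomial a fun p => by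
      simp [pointInd, Prod.ext_iff, and_comm]
  have r1 : xCoeff (-1) ρ = 0 := by
    rw [← walkGF_zero a]
    exact xCoeff_walkGF_horizontalMonomial a fun p => by
      rw [if_neg]; lia
  have r2 : xCoeff (-2) ρ = 0 := by
    rw [← walkGF_zero a]
    exact xCoeff_walkGF_horizontalMonomial a fun p => by
      rw [if_neg]; lia
  have s0 : xCoeff 0 ρi = G := by
    rw [hG, ← map_pointInd C]
    exact xCoeff_walkGF_horizontalMonomial a fun p => by
      simp [pointInd, Prod.ext_iff, and_comm]
  have s1 : xCoeff (-1) ρi = G₁ := by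
    rw [hG₁, ← map_pointInd C]
    exact xCoeff_walkGF_horizontalMonomial a fun p => by
      simp [pointInd, Prod.ext_iff, and_comm]
  have s2 : xCoeff 1 ρi = 0 := by
    rw [← walkGF_zero a]
    exact xCoeff_walkGF_horizontalMonomial a fun p => by
      rw [if_neg]; lia
  have hmC : PowerSeries.map (LaurentPolynomial.C : R →+* R[T;T⁻¹]) (C a) =
      C (LaurentPolynomial.C a) := map_C ..
  have hT2 : C (LaurentPolynomial.T 2 : R[T;T⁻¹]) = C (LaurentPolynomial.T 1) ^ 2 := by
    rw [← map_pow, LaurentPolynomial.T_pow]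
    rfl
  have key := congrArg (xCoeff 0) (show
    PowerSeries.map LaurentPolynomial.C (C a * ((C a - 1) * (C a - 1 + C a * X))) * ρ +
    C (LaurentPolynomial.T 1) * (PowerSeries.map LaurentPolynomial.C
      (C a * (1 - C a - 2 * C a * (C a - 1) * X)) * ρ) +
    C (LaurentPolynomial.T 2) * (PowerSeries.map LaurentPolynomial.C
      (C a * (C a * X * (1 + 2 * C a * X))) * ρ) +
    C (LaurentPolynomial.T 1) * (PowerSeries.map LaurentPolynomial.C
      (C a * ((C a - 1) * (C a - 1 + C a * X))) * ρi) +
    PowerSeries.map LaurentPolynomial.C (C a * (1 - C a - 2 * C a * (C a - 1) * X)) * ρi +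
    C (LaurentPolynomial.T (-1)) * (PowerSeries.map LaurentPolynomial.C
      (C a * (C a * X * (1 + 2 * C a * X))) * ρi) +
    PowerSeries.map LaurentPolynomial.C (1 - (C a - 1) ^ 2 * G) *
      (boundaryNum (C (LaurentPolynomial.C a)) X (C (LaurentPolynomial.T 1))
        (C (LaurentPolynomial.T (-1))) y * ia) = 0 by
    simp only [map_mul, map_add, map_sub, map_one, map_ofNat, PowerSeries.map_X, hmC, hT2, map_pow,
      hG, ← walkGF_pointInd_laurent]
    linear_combination (norm := (unfold boundaryPoly; ring)) ia * hb - C (LaurentPolynomial.C a) *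
      ((boundaryPoly (C (LaurentPolynomial.C a)) X (C (LaurentPolynomial.T 1)) * ρ +
        C (LaurentPolynomial.T 1) *
          boundaryPoly (C (LaurentPolynomial.C a)) X (C (LaurentPolynomial.T (-1))) * ρi) * hia) -
      C (LaurentPolynomial.C a) * (1 - C (LaurentPolynomial.C a) -
        2 * C (LaurentPolynomial.C a) * (C (LaurentPolynomial.C a) - 1) * X +
        C (LaurentPolynomial.C a) * X * (1 + 2 * C (LaurentPolynomial.C a) * X) *
          C (LaurentPolynomial.T (-1))) * ρi * h.mul_inv)
  simp only [map_add, map_zero, xCoeff_C_T_mul, xCoeff_map_mul, ← hτ, r0, s0, zero_sub, r1, r2,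
    sub_neg_eq_add, zero_add, s1, s2] at key
  have hGG := walkGF_pointInd_zero a
  rw [← hG, ← hG₁] at hGG
  linear_combination 2 * X * C a * key +
    (C a - 1) * (C a - 1 + C a * X) * hGG

end Excursions

section Residue

variable {B : Type*} [CommRing B] {t x xi v y : B}

/-- The discriminant of the kernel of Model 18, as a polynomial in the second coordinate. -/
def kernelDisc (t x : B) : B := (x - t * (x ^ 2 + 1)) ^ 2 - 4 * t ^ 2 * x * (1 + x) ^ 2

/-- The rational part of `2 * x * (a - 1 - a * v)`. -/
def invRat (a t x : B) : B := 2 * (a - 1) * x - a * (x - t * (x ^ 2 + 1))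

/-- The norm of `2 * x * (a - 1 - a * v)`. -/
def invNorm (a t x : B) : B := invRat a t x ^ 2 - a ^ 2 * kernelDisc t x

/-- The rational part of `4 * (1 + x) ^ 2 * x * boundaryNum a t x xi y`. -/
def numRat (a t x : B) : B :=
  4 * (1 + x) ^ 2 * (x * boundaryPoly a t x + (a - 1) * (a - 1 + a * t) * x ^ 2 +
    (1 - a - 2 * a * (a - 1) * t) * x + a * t * (1 + 2 * a * t)) -
  (1 + x) * ((2 * (1 + x) * ((a - 1) * x - a * t) - a * (x - t * (x ^ 2 + 1))) *
    (2 * (1 + x) * (a - 1 - a * t * x) - a * (x - t * (x ^ 2 + 1))) + a ^ 2 * kernelDisc t x)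

/-- The coefficient of the square root of the discriminant in
`4 * (1 + x) ^ 2 * x * boundaryNum a t x xi y`. -/
def numIrr (a t x : B) : B :=
  -((1 + x) * a * ((2 * (1 + x) * ((a - 1) * x - a * t) - a * (x - t * (x ^ 2 + 1))) +
    (2 * (1 + x) * (a - 1 - a * t * x) - a * (x - t * (x ^ 2 + 1)))))

lemma map_boundaryPoly {A : Type*} [CommRing A] (f : A →+* B) (a t x : A) :
    f (boundaryPoly a t x) = boundaryPoly (f a) (f t) (f x) := by
  simp [boundaryPoly, map_ofNat f]

lemma map_kernelDisc {A : Type*} [CommRing A] (f : A →+* B) (t x : A) :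
    f (kernelDisc t x) = kernelDisc (f t) (f x) := by
  simp [kernelDisc, map_ofNat f]

lemma map_invRat {A : Type*} [CommRing A] (f : A →+* B) (a t x : A) :
    f (invRat a t x) = invRat (f a) (f t) (f x) := by
  simp [invRat, map_ofNat f]

lemma map_invNorm {A : Type*} [CommRing A] (f : A →+* B) (a t x : A) :
    f (invNorm a t x) = invNorm (f a) (f t) (f x) := by
  simp [invNorm, map_invRat, map_kernelDisc]

lemma map_numRat {A : Type*} [CommRing A] (f : A →+* B) (a t x : A) :
    f (numRat a t x) = numRat (f a) (f t) (f x) := by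
  simp [numRat, map_boundaryPoly, map_kernelDisc, map_ofNat f]

lemma map_numIrr {A : Type*} [CommRing A] (f : A →+* B) (a t x : A) :
    f (numIrr a t x) = numIrr (f a) (f t) (f x) := by
  simp [numIrr, map_ofNat f]

namespace IsKernelRoot

lemma sqrt_sq (h : IsKernelRoot t x xi v y) :
    (2 * x * v - (x - t * (x ^ 2 + 1))) ^ 2 = kernelDisc t x := by
  unfold kernelDisc
  linear_combination 4 * x ^ 2 * v * h.add_eq - 4 * x ^ 2 * t * (1 + xi) * h.mul_eq -
    (4 * t ^ 2 * x * (1 + x) + 4 * x * v * t) * h.mul_inv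

lemma invNorm_mul (h : IsKernelRoot t x xi v y) {a ia : B} (hia : (a - 1 - a * v) * ia = 1) :
    invNorm a t x * ia =
      2 * x * (invRat a t x + a * (2 * x * v - (x - t * (x ^ 2 + 1)))) := by
  rw [invNorm, ← h.sqrt_sq]
  unfold invRat
  linear_combination 2 * x * ((2 * (a - 1) * x - a * (x - t * (x ^ 2 + 1))) +
    a * (2 * x * v - (x - t * (x ^ 2 + 1)))) * hia

lemma mul_boundaryNum (h : IsKernelRoot t x xi v y) (a : B) :
    4 * (1 + x) ^ 2 * x * boundaryNum a t x xi y =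
      numRat a t x + numIrr a t x * (2 * x * v - (x - t * (x ^ 2 + 1))) := by
  have hz : 2 * (1 + x) * t * y =
      (x - t * (x ^ 2 + 1)) - (2 * x * v - (x - t * (x ^ 2 + 1))) := by
    linear_combination 2 * x * h.add_eq - (2 * t * y + 2 * t) * h.mul_inv
  have h1 : 2 * (1 + x) * x * (a - 1 - a * t * (1 + y) * xi) =
      2 * (1 + x) * ((a - 1) * x - a * t) - a * (x - t * (x ^ 2 + 1)) +
        a * (2 * x * v - (x - t * (x ^ 2 + 1))) := by
    linear_combination -a * hz - 2 * (1 + x) * a * t * (1 + y) * h.mul_inv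
  have h2 : 2 * (1 + x) * (a - 1 - a * t * (x + y)) =
      2 * (1 + x) * (a - 1 - a * t * x) - a * (x - t * (x ^ 2 + 1)) +
        a * (2 * x * v - (x - t * (x ^ 2 + 1))) := by
    linear_combination -a * hz
  have h3 : x ^ 2 * boundaryPoly a t xi = (a - 1) * (a - 1 + a * t) * x ^ 2 +
      (1 - a - 2 * a * (a - 1) * t) * x + a * t * (1 + 2 * a * t) := by
    unfold boundaryPoly
    linear_combination ((1 - a - 2 * a * (a - 1) * t) * x +
      a * t * (1 + 2 * a * t) * (x * xi + 1)) * h.mul_inv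
  rw [numRat, ← h.sqrt_sq, numIrr, boundaryNum]
  linear_combination 4 * (1 + x) ^ 2 * h3 -
    (1 + x) * (2 * (1 + x) * (a - 1 - a * t * (x + y))) * h1 - (1 + x) *
    (2 * (1 + x) * ((a - 1) * x - a * t) - a * (x - t * (x ^ 2 + 1)) +
        a * (2 * x * v - (x - t * (x ^ 2 + 1)))) * h2

lemma denom_mul (h : IsKernelRoot t x xi v y) {a ia : B} (hia : (a - 1 - a * v) * ia = 1)
    (P Q : B) :
    2 * kernelDisc t x * (4 * (1 + x) ^ 2 * x ^ 2 * invNorm a t x) *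
      (xi * (P + Q * (boundaryNum a t x xi y * ia))) =
    2 * kernelDisc t x * (4 * (1 + x) ^ 2 * x * invNorm a t x * P + 2 * x * Q *
      (numRat a t x * invRat a t x + a * numIrr a t x * kernelDisc t x)) +
    2 * kernelDisc t x * (2 * x * Q * (a * numRat a t x + numIrr a t x * invRat a t x)) *
      (2 * x * v - (x - t * (x ^ 2 + 1))) := by
  linear_combination
    2 * kernelDisc t x * (4 * (1 + x) ^ 2 * x * invNorm a t x) *
      (P + Q * (boundaryNum a t x xi y * ia)) * h.mul_inv +
    2 * kernelDisc t x * Q * (4 * (1 + x) ^ 2 * x * boundaryNum a t x xi y) * h.invNorm_mul hia +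
    2 * kernelDisc t x * Q *
      (2 * x * (invRat a t x + a * (2 * x * v - (x - t * (x ^ 2 + 1))))) * h.mul_boundaryNum a +
    4 * kernelDisc t x * Q * x * a * numIrr a t x * h.sqrt_sq

end IsKernelRoot

section Derivative

variable {R : Type*} [CommRing R]

lemma txEmb_C_X : txEmb R (Polynomial.C Polynomial.X) = X := by
  rw [txEmb_C, tEmb_apply]; simp

lemma txEmb_C_C (a : R) :
    txEmb R (Polynomial.C (Polynomial.C a)) = C (LaurentPolynomial.C a) := by
  rw [txEmb_C, tEmb_apply, Polynomial.coe_C, map_C]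

lemma two_mul_derivation_of_sq {A : Type*} [CommRing A] [Algebra A B] (δ : Derivation A B B)
    {s d : B} (hs : s ^ 2 = d) : 2 * d * δ s = δ d * s := by
  subst hs
  rw [δ.leibniz_pow]
  simp only [smul_eq_mul, nsmul_eq_mul]
  push_cast
  ring

end Derivative

end Residue

section Main

variable {R : Type*} [CommRing R] [IsDomain R] [CharZero R] {v y : PowerSeries R[T;T⁻¹]}

lemma txEmb_denom_ne_zero {a : R} (ha : a ≠ 1) :
    txEmb R (2 * kernelDisc (Polynomial.C Polynomial.X : Polynomial (Polynomial R)) Polynomial.X *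
      (4 * (1 + Polynomial.X) ^ 2 * Polynomial.X ^ 2 *
        invNorm (Polynomial.C (Polynomial.C a)) (Polynomial.C Polynomial.X) Polynomial.X)) ≠ 0 := by
  intro h
  have hC : (LaurentPolynomial.C (-32 * (a - 1)) : R[T;T⁻¹]) ≠ 0 := by
    intro h0
    have := congrArg (fun p : R[T;T⁻¹] => p.coeff 0) h0
    simp only [LaurentPolynomial.C_apply] at this
    refine absurd this ?_
    simp only [if_true]
    exact mul_ne_zero (by norm_num) (sub_ne_zero.2 ha)
  have hT : (LaurentPolynomial.T 1 : R[T;T⁻¹]) ≠ 0 := (LaurentPolynomial.isUnit_T 1).ne_zero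
  have hT' : (1 + LaurentPolynomial.T 1 : R[T;T⁻¹]) ≠ 0 := fun h0 =>
    one_add_T_ne_zero (R := R) (by rw [← map_one C, ← map_add, h0, map_zero])
  refine mul_ne_zero (mul_ne_zero hC (pow_ne_zero 6 hT)) (pow_ne_zero 2 hT') ?_
  have h' := congrArg constantCoeff h
  simp only [kernelDisc, invNorm, invRat, map_mul, map_add, map_sub, map_pow, map_one, map_ofNat,
    map_zero, txEmb_C_X, txEmb_C_C, txEmb_X, constantCoeff_X, constantCoeff_C] at h'
  rw [map_mul, map_neg, map_ofNat, map_sub, map_one]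
  linear_combination h'

lemma IsKernelRoot.isDFinite
    (h : IsKernelRoot X (C (LaurentPolynomial.T 1)) (C (LaurentPolynomial.T (-1))) v y)
    {a : R} (ha : a ≠ 1) {ia : PowerSeries R[T;T⁻¹]}
    (hia : (C (LaurentPolynomial.C a) - 1 - C (LaurentPolynomial.C a) * v) * ia = 1)
    {τ : PowerSeries R} (hτ : τ = xCoeff 0 (boundaryNum (C (LaurentPolynomial.C a)) X
      (C (LaurentPolynomial.T 1)) (C (LaurentPolynomial.T (-1))) y * ia))
    (P Q : Polynomial R) : IsDFinite ((P : PowerSeries R) + (Q : PowerSeries R) * τ) := by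
  have hF : (P : PowerSeries R) + (Q : PowerSeries R) * τ =
      xCoeff (-1) (C (LaurentPolynomial.T (-1)) *
      (tEmb R P + tEmb R Q * (boundaryNum (C (LaurentPolynomial.C a)) X
      (C (LaurentPolynomial.T 1)) (C (LaurentPolynomial.T (-1))) y * ia))) := by
    have h1 : xCoeff 0 (1 : PowerSeries R[T;T⁻¹]) = 1 := by
      ext n
      rw [coeff_xCoeff, coeff_one, coeff_one]
      split_ifs <;> simp
    rw [xCoeff_C_T_mul, sub_self, map_add, tEmb_apply, tEmb_apply, xCoeff_map_mul, ← hτ,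
      ← mul_one (PowerSeries.map _ (P : PowerSeries R)), xCoeff_map_mul, h1, mul_one]
  rw [hF]
  set d : Polynomial (Polynomial R) := kernelDisc (Polynomial.C Polynomial.X) Polynomial.X with hd
  set e : Polynomial (Polynomial R) := 4 * (1 + Polynomial.X) ^ 2 * Polynomial.X ^ 2 *
    invNorm (Polynomial.C (Polynomial.C a)) (Polynomial.C Polynomial.X) Polynomial.X with he
  set x : PowerSeries R[T;T⁻¹] := C (LaurentPolynomial.T 1) with hx
  have hs : (2 * x * v - (x - X * (x ^ 2 + 1))) ^ 2 = txEmb R d := by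
    rw [h.sqrt_sq, hd]
    rw [map_kernelDisc, txEmb_C_X, txEmb_X]
  refine isDFinite_residue (D := 2 * d * e) (σx := Polynomial.derivative d * e)
    (σt := coeffDerivative d * e) (s := 2 * x * v - (x - X * (x ^ 2 + 1)))
    (txEmb_denom_ne_zero ha) ?_ ?_ ?_
  · have := two_mul_derivation_of_sq (xDeriv R) hs
    rw [xDeriv_txEmb] at this
    simp only [map_mul, map_ofNat]
    linear_combination txEmb R e * this
  · have := two_mul_derivation_of_sq (derivative R[T;T⁻¹]) hs
    rw [derivative_txEmb] at this
    simp only [map_mul, map_ofNat]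
    linear_combination txEmb R e * this
  · let ap : Polynomial (Polynomial R) := Polynomial.C (Polynomial.C a)
    let tp : Polynomial (Polynomial R) := Polynomial.C Polynomial.X
    refine ⟨2 * d * (4 * (1 + Polynomial.X) ^ 2 * Polynomial.X * invNorm ap tp Polynomial.X *
        Polynomial.C P + 2 * Polynomial.X * Polynomial.C Q *
        (numRat ap tp Polynomial.X * invRat ap tp Polynomial.X
          + ap * numIrr ap tp Polynomial.X * d)),
      2 * d * (2 * Polynomial.X * Polynomial.C Q * (ap * numRat ap tp Polynomial.X +
        numIrr ap tp Polynomial.X * invRat ap tp Polynomial.X)), ?_⟩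
    simp only [ap, tp, hd, he, map_mul, map_add, map_pow, map_one, map_ofNat, map_kernelDisc,
      map_invRat, map_invNorm, map_numRat, map_numIrr, txEmb_C_X, txEmb_C_C, txEmb_X, txEmb_C P,
      txEmb_C Q]
    exact h.denom_mul hia (tEmb R P) (tEmb R Q)

/-- Over a domain of characteristic zero, the equal-weight excursion series of Model 18 with
weight `a ≠ 1` is a ratio of D-finite series. -/
lemma exists_isDFinite_ratio {a : R} (ha : a ≠ 1) :
    ∃ F H : PowerSeries R, IsDFinite F ∧ IsDFinite H ∧ H ≠ 0 ∧
      H * loopGF model18Steps a a = F := by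
  obtain ⟨v, y, h, hy⟩ := exists_isKernelRoot R
  obtain ⟨ia, hia⟩ := h.exists_inv a
  obtain ⟨τ, hτ⟩ : ∃ τ, τ = xCoeff 0 (boundaryNum (C (LaurentPolynomial.C a)) X
    (C (LaurentPolynomial.T 1)) (C (LaurentPolynomial.T (-1))) y * ia) := ⟨_, rfl⟩
  have hG : loopGF model18Steps a a = walkGF (C a) (pointInd _ (0, 0)) := by
    rw [loopGF_model18, ← walkGF_C, map_pointInd]
  have h2 : ((2 : Polynomial R) : PowerSeries R) = 2 :=
    map_ofNat Polynomial.coeToPowerSeries.ringHom 2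
  refine ⟨_, _, ?_, ?_, ?_, (congrArg _ hG).trans (h.walkGF_equation hy a hia hτ)⟩
  · have := h.isDFinite ha hia hτ ((Polynomial.C a - 1) * (Polynomial.C a - 1 +
      Polynomial.C a * Polynomial.X)) (-(2 * Polynomial.X * Polynomial.C a))
    push_cast at this
    simp only [h2] at this
    rwa [neg_mul, ← sub_eq_add_neg] at this
  · have := h.isDFinite ha hia hτ ((Polynomial.C a - 1) * (Polynomial.C a - 1 +
      Polynomial.C a * Polynomial.X) + 2 * Polynomial.X * Polynomial.C a ^ 2 *
      ((Polynomial.C a - 1) * (Polynomial.C a - 1 + Polynomial.C a * Polynomial.X) +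
        (1 - Polynomial.C a - 2 * Polynomial.C a * (Polynomial.C a - 1) * Polynomial.X)))
      (-(2 * Polynomial.X * Polynomial.C a * (Polynomial.C a - 1) ^ 2))
    push_cast at this
    simp only [h2] at this
    rwa [neg_mul, ← sub_eq_add_neg] at this
  · intro h0
    have := congrArg constantCoeff h0
    simp at this
    exact ha (sub_eq_zero.1 this)

end Main

/-- Model 18: the equal-weight generating function `G(t;a,a)` is a ratio of
D-finite series in `ℚ[a][[t]]`. -/
theorem model18_Gaa_ratio_of_dfinite :
    ∃ F H : PowerSeries (Polynomial ℚ),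
      IsDFinite F ∧ IsDFinite H ∧ H ≠ 0 ∧
      H * loopGF ({((1:ℤ), (0:ℤ)), (-1, 0), (0, 1), (0, -1), (1, -1), (-1, 1)} : Set (ℤ × ℤ))
        (Polynomial.X : Polynomial ℚ) Polynomial.X = F :=
  exists_isDFinite_ratio (Polynomial.X_ne_C 1)
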